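/- Let ρ = δ_1 ∧ … ∧ δ_k be a CNF formula over variables x_1,…,x_n containing no valid clause, where in each clause each variable occurs at most once. For x ∈ {0,1}^n and i ∈ {1,…,k}, let diff(δ_i, x) be the number of literals of δ_i falsified by x minus the number of literals of δ_i satisfied by x, and set x'_i = sgn(2·diff(δ_i, x) − 2|δ_i| + 1) ∈ {−1,1}, where sgn(z) = 1 if z ≥ 0 and sgn(z) = −1 if z < 0. Define w_1 = Σ_{i=1}^k x'_i + 2k and w_2 = −Σ_{i=1}^k x'_i + 1. Then for every x ∈ {0,1}^n, w_2 > w_1 if and only if ρ(x) = 1; that is, the binarized neural network built from ρ in this way classifies transl(x) positively exactly on the models of ρ. -/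

import Mathlib

/-- A literal is a variable together with a polarity (`true` for `x_i`,
`false` for `¬x_i`); a clause is a disjunction of literals. -/
abbrev Clause (n : ℕ) := List (Fin n × Bool)

/-- A CNF formula is a conjunction of clauses. -/
abbrev CNF (n : ℕ) := List (Clause n)

/-- A clause evaluates to `true` on `x` iff some of its literals is satisfied by `x`. -/
def Clause.eval {n : ℕ} (δ : Clause n) (x : Fin n → Bool) : Bool :=
  δ.any fun l => x l.1 == l.2

/-- A CNF formula evaluates to `true` on `x` iff all of its clauses do. -/
def CNF.eval {n : ℕ} (α : CNF n) (x : Fin n → Bool) : Bool :=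
  α.all fun δ => Clause.eval δ x

/-- A CNF formula is satisfiable if some instance evaluates it to `true`. -/
def CNF.Satisfiable {n : ℕ} (α : CNF n) : Prop := ∃ x, CNF.eval α x = true

/-- `diff δ x` = (number of literals of `δ` falsified by `x`)
              - (number of literals of `δ` satisfied by `x`). -/
def diff {n : ℕ} (δ : Clause n) (x : Fin n → Bool) : ℤ :=
  ((δ.countP fun l => x l.1 != l.2 : ℕ) : ℤ) -
    ((δ.countP fun l => x l.1 == l.2 : ℕ) : ℤ)

/-- The binarization function: `sgn z = 1` if `z ≥ 0` and `sgn z = -1` if `z < 0`. -/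
def isgn (z : ℤ) : ℤ := if 0 ≤ z then 1 else -1

theorem Clause.eval_eq_true_iff_countP_pos {n : ℕ} (δ : Clause n) (x : Fin n → Bool) :
    Clause.eval δ x = true ↔ 0 < δ.countP fun l => x l.1 == l.2 := by
  rw [Clause.eval, List.any_eq_true, List.countP_pos_iff]

theorem diff_eq_length_sub {n : ℕ} (δ : Clause n) (x : Fin n → Bool) :
    diff δ x = (δ.length : ℤ) - 2 * ((δ.countP fun l => x l.1 == l.2 : ℕ) : ℤ) := by
  have h : δ.length = (δ.countP fun l => x l.1 == l.2) + δ.countP fun l => x l.1 != l.2 := by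
    rw [List.length_eq_countP_add_countP fun l : Fin n × Bool => x l.1 == l.2]
    congr 2
    funext l
    cases x l.1 <;> cases l.2 <;> rfl
  rw [diff, h]
  push_cast
  ring

/-- The neuron of a clause outputs `-1` exactly when the clause is satisfied. -/
theorem isgn_diff_eq {n : ℕ} (δ : Clause n) (x : Fin n → Bool) :
    isgn (2 * diff δ x - 2 * (δ.length : ℤ) + 1) =
      if Clause.eval δ x = true then -1 else 1 := by
  simp only [Clause.eval_eq_true_iff_countP_pos, diff_eq_length_sub, isgn]
  split_ifs <;> omega

/-- The clause outputs sum to at least `-k`, with equality exactly on the models. -/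
theorem sum_isgn_diff {n : ℕ} (α : CNF n) (x : Fin n → Bool) :
    -(α.length : ℤ) ≤ (α.map fun δ => isgn (2 * diff δ x - 2 * (δ.length : ℤ) + 1)).sum ∧
      ((α.map fun δ => isgn (2 * diff δ x - 2 * (δ.length : ℤ) + 1)).sum = -(α.length : ℤ) ↔
        CNF.eval α x = true) := by
  simp only [isgn_diff_eq]
  induction α with
  | nil => simp [CNF.eval]
  | cons δ α ih =>
    have h : CNF.eval (δ :: α) x = true ↔ Clause.eval δ x = true ∧ CNF.eval α x = true := by
      simp [CNF.eval]
    rw [h, ← ih.2, List.map_cons, List.sum_cons, List.length_cons]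
    push_cast
    have := ih.1
    split_ifs with hδ
    · simp only [hδ, true_and]
      omega
    · simp only [hδ, Bool.false_eq_true, false_and, iff_false]
      omega

theorem stmt17 (n : ℕ) (α : CNF n)
    (hnv : ∀ δ ∈ α, ∃ x, Clause.eval δ x = false)
    (hnd : ∀ δ ∈ α, (δ.map Prod.fst).Nodup)
    (x : Fin n → Bool)
    (w1 w2 : ℤ)
    (h1 : w1 =
      ((α.map fun δ => isgn (2 * diff δ x - 2 * (δ.length : ℤ) + 1)).sum) +
        2 * (α.length : ℤ))
    (h2 : w2 =
      -((α.map fun δ => isgn (2 * diff δ x - 2 * (δ.length : ℤ) + 1)).sum) + 1) :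
    w2 > w1 ↔ CNF.eval α x = true := by
  obtain ⟨hle, heq⟩ := sum_isgn_diff α x
  rw [← heq]
  omega
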